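/- Let n be a positive integer, let B be a compact convex subset of ℝ^{n+1} with nonempty interior, let p be a point in the interior of B, and let f be a continuous map from the frontier of B to ℝⁿ. Then there exist points x and y on the frontier of B such that p lies in the open segment joining x and y (so in particular x ≠ y, and x, y are the two intersection points with the frontier of the line through p that they span) and f(x) = f(y). -/

import Mathlib

/-- A commutative real algebra having a module of odd finite real dimension has a real point. -/
theorem exists_algHom_real_of_odd_finrank {A : Type*} [CommRing A] [Algebra ℝ A] (k : ℕ) :
    ∀ (M : Type*) [AddCommGroup M] [Module ℝ M] [Module A M] [IsScalarTower ℝ A M]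
      [FiniteDimensional ℝ M], Module.finrank ℝ M = k → Odd k → Nonempty (A →ₐ[ℝ] ℝ) := by
  induction k using Nat.strong_induction_on with
  | _ k ih =>
  intro M _ _ _ _ _ hk hodd
  have : Nontrivial M := by
    rw [← Module.finrank_pos_iff (R := ℝ), hk]
    exact hodd.pos
  by_cases hs : IsSimpleModule A M
  · obtain ⟨I, hI, ⟨e⟩⟩ := isSimpleModule_iff_quot_maximal.mp hs
    let : Field (A ⧸ I) := Ideal.Quotient.field I
    let e' : M ≃ₗ[ℝ] A ⧸ I := e.restrictScalars ℝ
    have : FiniteDimensional ℝ (A ⧸ I) := e'.finiteDimensional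
    have hfr : Module.finrank ℝ (A ⧸ I) = k := by rw [← e'.finrank_eq, hk]
    obtain ⟨⟨φ⟩⟩ | ⟨⟨φ⟩⟩ := Real.nonempty_algEquiv_or (A ⧸ I)
    · exact ⟨φ.toAlgHom.comp (Ideal.Quotient.mkₐ ℝ I)⟩
    · rw [φ.toLinearEquiv.finrank_eq, Complex.finrank_real_complex] at hfr
      exact absurd (hfr ▸ hodd) (by decide)
  · obtain ⟨W, hbot, htop⟩ : ∃ W : Submodule A M, W ≠ ⊥ ∧ W ≠ ⊤ := by
      by_contra! h
      exact hs { eq_bot_or_eq_top := fun W => or_iff_not_imp_left.mpr (h W) }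
    have hsum := Submodule.finrank_quotient_add_finrank (W.restrictScalars ℝ)
    have h1 : 0 < Module.finrank ℝ W := by
      have : Nontrivial W := Submodule.nontrivial_iff_ne_bot.mpr hbot
      have : FiniteDimensional ℝ W :=
        inferInstanceAs (FiniteDimensional ℝ (W.restrictScalars ℝ))
      exact Module.finrank_pos
    have h2 : 0 < Module.finrank ℝ (M ⧸ W) := by
      have : Nontrivial (M ⧸ W) := Submodule.Quotient.nontrivial_iff.mpr htop
      have : FiniteDimensional ℝ (M ⧸ W) :=
        Module.Finite.of_surjective (W.mkQ.restrictScalars ℝ) W.mkQ_surjective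
      exact Module.finrank_pos
    have h3 : Module.finrank ℝ (M ⧸ W) + Module.finrank ℝ W = k := by
      rw [← hk]; exact hsum
    have : FiniteDimensional ℝ (M ⧸ W) :=
        Module.Finite.of_surjective (W.mkQ.restrictScalars ℝ) W.mkQ_surjective
    have : FiniteDimensional ℝ W :=
      inferInstanceAs (FiniteDimensional ℝ (W.restrictScalars ℝ))
    rcases Nat.even_or_odd (Module.finrank ℝ W) with he | ho
    · have : Odd (Module.finrank ℝ (M ⧸ W)) := by
        rw [← h3] at hodd
        exact (Nat.odd_add.mp hodd).mpr he
      exact ih _ (by omega) (M ⧸ W) rfl this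
    · exact ih _ (by omega) W rfl ho

namespace MvPolynomial

variable {σ R S : Type*} [Fintype σ] [CommRing R] [CommRing S]

/-- The substitution of `h i` for `X i ^ D` in the monomial with exponent `a`. -/
noncomputable def powerProd (D : ℕ) (h : σ → MvPolynomial σ R) (a : σ →₀ ℕ) :
    MvPolynomial σ R :=
  ∏ i, (X i ^ (a i % D) * h i ^ (a i / D))

theorem powerProd_X_pow (D : ℕ) (a : σ →₀ ℕ) :
    powerProd D (fun i => (X i ^ D : MvPolynomial σ R)) a = monomial a 1 := by
  rw [monomial_eq, Finsupp.prod_fintype _ _ (by simp)]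
  simp [powerProd, ← pow_mul, ← pow_add, Nat.mod_add_div]

theorem map_powerProd (φ : R →+* S) (D : ℕ) (h : σ → MvPolynomial σ R) (a : σ →₀ ℕ) :
    map φ (powerProd D h a) = powerProd D (fun i => map φ (h i)) a := by
  simp [powerProd, map_prod]

theorem powerProd_add_single {D : ℕ} (hD : 0 < D) (h : σ → MvPolynomial σ R) (a : σ →₀ ℕ)
    (i : σ) : powerProd D h (a + Finsupp.single i D) = h i * powerProd D h a := by
  classical
  have : h i = ∏ j, if j = i then h j else 1 := by simp
  rw [this, powerProd, powerProd, ← Finset.prod_mul_distrib]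
  refine Finset.prod_congr rfl fun j _ => ?_
  by_cases hj : j = i
  · subst hj
    simp only [Finsupp.add_apply, Finsupp.single_eq_same, Nat.add_mod_right,
      Nat.add_div_right _ hD, if_true]
    ring
  · simp [hj]

theorem totalDegree_powerProd_le {D : ℕ} {h : σ → MvPolynomial σ R}
    (hh : ∀ i, (h i).totalDegree ≤ D) (a : σ →₀ ℕ) :
    (powerProd D h a).totalDegree ≤ a.degree := by
  cases subsingleton_or_nontrivial R
  · simp [Subsingleton.elim (powerProd D h a) 0]
  rw [Finsupp.degree_eq_sum]
  refine (totalDegree_finsetProd _ _).trans (Finset.sum_le_sum fun i _ => ?_)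
  calc (X i ^ (a i % D) * h i ^ (a i / D)).totalDegree
      ≤ a i % D + a i / D * D := by
        refine (totalDegree_mul _ _).trans (add_le_add ?_ ?_)
        · rw [totalDegree_X_pow]
        · exact (totalDegree_pow _ _).trans (Nat.mul_le_mul_left _ (hh i))
    _ = a i := Nat.mod_add_div' _ _

/-- The linear endomorphism substituting `h i` for `X i ^ D` in every monomial. -/
noncomputable def substPow (D : ℕ) (h : σ → MvPolynomial σ R) :
    MvPolynomial σ R →ₗ[R] MvPolynomial σ R :=
  (basisMonomials σ R).constr R (powerProd D h)

theorem substPow_monomial (D : ℕ) (h : σ → MvPolynomial σ R) (a : σ →₀ ℕ) (r : R) :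
    substPow D h (monomial a r) = r • powerProd D h a := by
  have : monomial a r = r • basisMonomials σ R a := by simp [smul_monomial]
  rw [this, map_smul, substPow, Module.Basis.constr_basis]

theorem substPow_X_pow_mul {D : ℕ} (hD : 0 < D) (h : σ → MvPolynomial σ R) (i : σ)
    (p : MvPolynomial σ R) : substPow D h (X i ^ D * p) = h i * substPow D h p := by
  induction p using MvPolynomial.induction_on' with
  | monomial a r =>
    rw [X_pow_eq_monomial, monomial_mul, one_mul, add_comm, substPow_monomial, substPow_monomial,
      powerProd_add_single hD, mul_smul_comm]
  | add p q hp hq => rw [mul_add, map_add, map_add, mul_add, hp, hq]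

/-- The exponents of degree at most `N`. -/
noncomputable def degreeLE (σ : Type*) [Fintype σ] (N : ℕ) : Finset (σ →₀ ℕ) :=
  (Finsupp.finite_of_degree_le N).toFinset

theorem mem_degreeLE {N : ℕ} {a : σ →₀ ℕ} : a ∈ degreeLE σ N ↔ a.degree ≤ N := by
  simp [degreeLE]

theorem coeff_eq_zero_of_notMem_degreeLE {N : ℕ} {p : MvPolynomial σ R} (hp : p.totalDegree ≤ N)
    {a : σ →₀ ℕ} (ha : a ∉ degreeLE σ N) : coeff a p = 0 := by
  rw [mem_degreeLE, not_le] at ha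
  exact coeff_eq_zero_of_totalDegree_lt (hp.trans_lt ha)

/-- The matrix of `substPow` on polynomials of total degree at most `N`. -/
noncomputable def substPowMatrix (D : ℕ) (h : σ → MvPolynomial σ R) (N : ℕ) :
    Matrix (degreeLE σ N) (degreeLE σ N) R :=
  .of fun b a => coeff b.1 (powerProd D h a.1)

theorem coeff_substPow_sum (D : ℕ) (h : σ → MvPolynomial σ R) (N : ℕ) (v : degreeLE σ N → R)
    (b : degreeLE σ N) :
    coeff b.1 (substPow D h (∑ a, monomial a.1 (v a))) = (substPowMatrix D h N).mulVec v b := by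
  simp [Matrix.mulVec, dotProduct, substPowMatrix, map_sum, coeff_sum, substPow_monomial, mul_comm]

theorem eq_sum_degreeLE {N : ℕ} {p : MvPolynomial σ R} (hp : p.totalDegree ≤ N) :
    p = ∑ a : degreeLE σ N, monomial a.1 (coeff a.1 p) := by
  classical
  ext b
  rw [Finset.sum_coe_sort (degreeLE σ N) (fun a => monomial a (coeff a p)), coeff_sum]
  simp only [coeff_monomial, Finset.sum_ite_eq']
  split_ifs with hb
  · rfl
  · exact coeff_eq_zero_of_notMem_degreeLE hp hb

theorem substPow_bijective {K : Type*} [Field K] {D : ℕ} {h : σ → MvPolynomial σ K}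
    (hh : ∀ i, (h i).totalDegree ≤ D) (hdet : ∀ N, (substPowMatrix D h N).det ≠ 0) :
    Function.Bijective (substPow D h) := by
  constructor
  · rw [← LinearMap.ker_eq_bot, LinearMap.ker_eq_bot']
    intro p hp
    have hv := Matrix.eq_zero_of_mulVec_eq_zero (hdet p.totalDegree)
      (v := fun a => coeff a.1 p) (by
        ext b
        rw [← coeff_substPow_sum, ← eq_sum_degreeLE le_rfl, hp]
        simp)
    rw [eq_sum_degreeLE (p := p) le_rfl]
    exact Finset.sum_eq_zero fun a _ => by
      rw [show coeff a.1 p = 0 from congrFun hv a, monomial_zero]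
  · intro p
    set N := p.totalDegree
    let v := (substPowMatrix D h N)⁻¹.mulVec fun a => coeff a.1 p
    refine ⟨∑ a, monomial a.1 (v a), ?_⟩
    ext b
    by_cases hb : b ∈ degreeLE σ N
    · rw [coeff_substPow_sum D h N v ⟨b, hb⟩, Matrix.mulVec_mulVec,
        Matrix.mul_nonsing_inv _ (hdet N).isUnit, Matrix.one_mulVec]
    · rw [coeff_eq_zero_of_notMem_degreeLE le_rfl hb]
      refine coeff_eq_zero_of_notMem_degreeLE ?_ hb
      rw [map_sum]
      refine totalDegree_finsetSum_le fun a _ => ?_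
      rw [substPow_monomial]
      exact (totalDegree_smul_le _ _).trans
        ((totalDegree_powerProd_le hh _).trans (mem_degreeLE.mp a.2))

theorem countable_not_bijective_substPow (D : ℕ) {K : Type*} [Field K]
    {g : σ → MvPolynomial σ K} (hg : ∀ i, (g i).totalDegree ≤ D) :
    {t : K | ¬ Function.Bijective (substPow D fun i => X i ^ D + C t * g i)}.Countable := by
  let H : σ → MvPolynomial σ (Polynomial K) :=
    fun i => X i ^ D + C Polynomial.X * map Polynomial.C (g i)
  have hH (t : K) (i : σ) : map (Polynomial.evalRingHom t) (H i) = X i ^ D + C t * g i := by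
    have : (Polynomial.evalRingHom t).comp Polynomial.C = RingHom.id K := by ext; simp
    simp [H, map_map, this, map_id]
  have hdet (t : K) (N : ℕ) : (substPowMatrix D H N).det.eval t =
      (substPowMatrix D (fun i => X i ^ D + C t * g i) N).det := by
    rw [← Polynomial.coe_evalRingHom, RingHom.map_det]
    congr 1
    ext b a
    simp only [RingHom.mapMatrix_apply, Matrix.map_apply, substPowMatrix, Matrix.of_apply]
    rw [← coeff_map, map_powerProd]
    simp only [hH]
  have hne (N : ℕ) : (substPowMatrix D H N).det ≠ 0 := by
    intro h0
    have h1 := hdet 0 N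
    have : substPowMatrix D (fun i => X i ^ D + C (0 : K) * g i) N = 1 := by
      ext b a
      simp only [map_zero, zero_mul, add_zero, substPowMatrix, powerProd_X_pow, Matrix.of_apply,
        Matrix.one_apply, Subtype.ext_iff]
      classical
      rw [coeff_monomial]
      by_cases hba : b.1 = a.1
      · simp [hba]
      · simp [hba, Ne.symm hba]
    rw [h0, this, Matrix.det_one] at h1
    simp at h1
  refine (Set.countable_iUnion fun N =>
    (Polynomial.finite_setOfPred_isRoot (hne N)).countable).mono fun t ht => ?_
  by_contra hcon
  simp only [Set.mem_iUnion, Set.mem_ofPred_eq, not_exists, Polynomial.IsRoot, hdet] at hcon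
  refine ht (substPow_bijective (fun i => ?_) hcon)
  refine (totalDegree_add _ _).trans (max_le ?_ ?_)
  · rw [totalDegree_X_pow]
  · rw [← smul_eq_C_mul]
    exact (totalDegree_smul_le _ _).trans (hg i)

theorem exists_eval_eq_zero_of_substPow_bijective {D : ℕ} (hD : Odd D)
    {h : σ → MvPolynomial σ ℝ} (hh : Function.Bijective (substPow D h)) :
    ∃ x : σ → ℝ, ∀ i, eval x (h i) = 0 := by
  classical
  have hD0 := hD.pos
  let e := LinearEquiv.ofBijective (substPow D h) hh
  let E (c : σ → Fin D) : σ →₀ ℕ := Finsupp.equivFunOnFinite.symm fun i => (c i : ℕ)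
  have hE (c c' : σ → Fin D) : E c = E c' ↔ c = c' := by
    refine ⟨fun hc => _root_.funext fun i => Fin.ext ?_, fun hc => hc ▸ rfl⟩
    simpa [E] using DFunLike.congr_fun hc i
  let ρ : MvPolynomial σ ℝ →ₗ[ℝ] ((σ → Fin D) → ℝ) := LinearMap.pi fun c => lcoeff ℝ (E c)
  have hρ (p) (c) : ρ p c = coeff (E c) p := rfl
  have hρsurj : Function.Surjective ρ := fun v => by
    refine ⟨∑ c, monomial (E c) (v c), ?_⟩
    ext c
    simp [hρ, coeff_sum, coeff_monomial, hE]
  let I : Ideal (MvPolynomial σ ℝ) := Ideal.span (Set.range h)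
  have hker (q) : ρ q = 0 ↔ e q ∈ I := by
    constructor
    · intro hq
      rw [q.as_sum, map_sum]
      refine Ideal.sum_mem _ fun a ha => ?_
      obtain ⟨i, hi⟩ : ∃ i, D ≤ a i := by
        by_contra! hlt
        have : E (fun i => ⟨a i, hlt i⟩) = a := by ext i; simp [E]
        have h2 := congrFun hq (fun i => ⟨a i, hlt i⟩)
        rw [hρ, this] at h2
        exact mem_support_iff.mp ha h2
      have hai : a = (a - Finsupp.single i D) + Finsupp.single i D := by
        rw [tsub_add_cancel_of_le]
        simpa using hi
      change substPow D h _ ∈ I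
      rw [substPow_monomial, hai, powerProd_add_single hD0, smul_eq_C_mul]
      exact I.mul_mem_left _ (I.mul_mem_right _ (Ideal.subset_span ⟨i, rfl⟩))
    · intro hq
      obtain ⟨r, hr⟩ := Ideal.mem_span_range_iff_exists_fun.mp hq
      have hq' : q = ∑ i, X i ^ D * e.symm (r i) := by
        apply e.injective
        rw [← hr, map_sum]
        refine Finset.sum_congr rfl fun i _ => ?_
        change _ = substPow D h _
        rw [substPow_X_pow_mul hD0, mul_comm]
        exact congrArg _ (e.apply_symm_apply _).symm
      ext c
      rw [hρ, hq', coeff_sum]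
      refine Finset.sum_eq_zero fun i _ => ?_
      rw [X_pow_eq_monomial, coeff_monomial_mul', if_neg]
      simp [E]
  have hIker : I.restrictScalars ℝ = LinearMap.ker (ρ ∘ₗ e.symm.toLinearMap) := by
    ext p
    simp [hker]
  let eq : (MvPolynomial σ ℝ ⧸ I) ≃ₗ[ℝ] ((σ → Fin D) → ℝ) :=
    (Submodule.Quotient.restrictScalarsEquiv ℝ I).symm ≪≫ₗ
      Submodule.quotEquivOfEq _ _ hIker ≪≫ₗ
      LinearMap.quotKerEquivOfSurjective _ (hρsurj.comp e.symm.surjective)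
  have : FiniteDimensional ℝ (MvPolynomial σ ℝ ⧸ I) := eq.symm.finiteDimensional
  have hfr : Module.finrank ℝ (MvPolynomial σ ℝ ⧸ I) = D ^ Fintype.card σ := by
    rw [eq.finrank_eq]
    simp
  obtain ⟨φ⟩ := exists_algHom_real_of_odd_finrank (A := MvPolynomial σ ℝ ⧸ I) _
    (MvPolynomial σ ℝ ⧸ I) hfr hD.pow
  refine ⟨fun i => φ (Ideal.Quotient.mk I (X i)), fun i => ?_⟩
  have h1 := aeval_unique (φ.comp (Ideal.Quotient.mkₐ ℝ I))
  have h2 := DFunLike.congr_fun h1 (h i)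
  simp only [AlgHom.comp_apply, Ideal.Quotient.mkₐ_eq_mk] at h2
  rw [Ideal.Quotient.eq_zero_iff_mem.mpr (Ideal.subset_span (Set.mem_range_self i)), map_zero] at h2
  exact h2.symm

theorem IsHomogeneous.eval_mul_left {D : ℕ} {p : MvPolynomial σ R} (hp : p.IsHomogeneous D)
    (c : R) (x : σ → R) : eval (fun i => c * x i) p = c ^ D * eval x p := by
  rw [eval_eq', eval_eq', Finset.mul_sum]
  refine Finset.sum_congr rfl fun d hd => ?_
  have hdeg : ∑ i, d i = D := by
    rw [← Finsupp.degree_eq_sum]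
    by_contra hne
    exact mem_support_iff.mp hd (hp.coeff_eq_zero hne)
  simp only [mul_pow, Finset.prod_mul_distrib, Finset.prod_pow_eq_pow_sum, hdeg]
  ring

theorem totalDegree_aeval_le {τ : Type*} {f : σ → MvPolynomial τ R}
    (hf : ∀ i, (f i).totalDegree ≤ 1) (p : MvPolynomial σ R) :
    (aeval f p).totalDegree ≤ p.totalDegree := by
  rw [aeval_def, eval₂_eq']
  refine totalDegree_finsetSum_le fun d hd => ?_
  rw [algebraMap_eq, ← smul_eq_C_mul]
  refine (totalDegree_smul_le _ _).trans ((totalDegree_finsetProd _ _).trans ?_)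
  refine le_trans ?_ (le_totalDegree hd)
  rw [Finsupp.sum_fintype _ _ (by simp)]
  refine Finset.sum_le_sum fun i _ => (totalDegree_pow _ _).trans ?_
  simpa using Nat.mul_le_mul_left (d i) (hf i)

/-- Finitely many forms of the same odd degree, one fewer than the number of variables, become
simultaneously arbitrarily small on the unit sphere. -/
theorem exists_sphere_abs_eval_le {n D : ℕ} (hD : Odd D)
    {G : Fin n → MvPolynomial (Fin (n + 1)) ℝ} (hG : ∀ i, (G i).IsHomogeneous D)
    {δ : ℝ} (hδ : 0 < δ) :
    ∃ u : Metric.sphere (0 : EuclideanSpace ℝ (Fin (n + 1))) 1,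
      ∀ i, |eval (fun j => u.1 j) (G i)| ≤ δ := by
  let f : Fin (n + 1) → MvPolynomial (Fin n) ℝ := Fin.cons 1 X
  have hf (j) : (f j).totalDegree ≤ 1 := by
    refine Fin.cases ?_ (fun i => ?_) j
    · simp [f]
    · simp [f]
  have hgdeg (i) : (aeval f (G i)).totalDegree ≤ D :=
    (totalDegree_aeval_le hf _).trans (hG i).totalDegree_le
  obtain ⟨t, ht, hlt⟩ :=
    ((countable_not_bijective_substPow D hgdeg).dense_compl ℝ).exists_gt δ⁻¹
  have ht0 : 0 < t := (inv_pos.mpr hδ).trans hlt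
  obtain ⟨x, hx⟩ := exists_eval_eq_zero_of_substPow_bijective hD (not_not.mp ht)
  let z : EuclideanSpace ℝ (Fin (n + 1)) := WithLp.toLp 2 (Fin.cons 1 x)
  have hz0 : z 0 = 1 := by simp [z]
  have hzs (i : Fin n) : z i.succ = x i := by simp [z]
  have hz : z ≠ 0 := fun h => by simp [h] at hz0
  have heval (i) : eval x (aeval f (G i)) = eval (fun j => z j) (G i) := by
    rw [← coe_aeval_eq_eval, ← coe_aeval_eq_eval]
    change aeval x (aeval f (G i)) = aeval _ (G i)
    rw [← AlgHom.comp_apply, comp_aeval]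
    congr 2
    ext j
    refine Fin.cases ?_ (fun i => ?_) j
    · simp [f, hz0]
    · simp [f, hzs]
  have hu : ‖‖z‖⁻¹ • z‖ = 1 := by
    rw [norm_smul, norm_inv, norm_norm, inv_mul_cancel₀ (norm_ne_zero_iff.mpr hz)]
  refine ⟨⟨‖z‖⁻¹ • z, by simpa using hu⟩, fun i => ?_⟩
  have h1 : z i.succ ^ D + t * eval (fun j => z j) (G i) = 0 := by
    have := hx i
    rw [map_add, map_pow, map_mul, eval_X, eval_C, heval] at this
    rwa [hzs]
  have h2 : eval (fun j => (‖z‖⁻¹ • z) j) (G i) = ‖z‖⁻¹ ^ D * eval (fun j => z j) (G i) :=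
    (hG i).eval_mul_left _ _
  have h3 : t * eval (fun j => (‖z‖⁻¹ • z) j) (G i) = -((‖z‖⁻¹ • z) i.succ ^ D) := by
    rw [h2]
    simp only [PiLp.smul_apply, smul_eq_mul, mul_pow]
    linear_combination ‖z‖⁻¹ ^ D * h1
  have h4 : |(‖z‖⁻¹ • z) i.succ| ≤ 1 := by
    have := PiLp.norm_apply_le (‖z‖⁻¹ • z) i.succ
    rwa [hu, Real.norm_eq_abs] at this
  have h5 : t * |eval (fun j => (‖z‖⁻¹ • z) j) (G i)| ≤ 1 := by
    have := abs_mul t (eval (fun j => (‖z‖⁻¹ • z) j) (G i))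
    rw [abs_of_pos ht0] at this
    rw [← this, h3, abs_neg, abs_pow]
    exact pow_le_one₀ (abs_nonneg _) h4
  change |eval (fun j => (‖z‖⁻¹ • z) j) (G i)| ≤ δ
  calc _ ≤ 1 / t := by rw [le_div_iff₀' ht0]; exact h5
    _ ≤ δ := by
      rw [one_div]
      exact inv_le_of_inv_le₀ hδ hlt.le

theorem exists_eval_near_of_continuous {n : ℕ}
    {F : Metric.sphere (0 : EuclideanSpace ℝ (Fin n)) 1 → ℝ} (hF : Continuous F)
    {ε : ℝ} (hε : 0 < ε) :
    ∃ p : MvPolynomial (Fin n) ℝ, ∀ u, |eval (fun j => u.1 j) p - F u| < ε := by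
  let c : Fin n → C(Metric.sphere (0 : EuclideanSpace ℝ (Fin n)) 1, ℝ) :=
    fun j => ⟨fun u => u.1 j, by fun_prop⟩
  obtain ⟨⟨_, p, rfl⟩, hp⟩ :=
    ContinuousMap.exists_mem_subalgebra_near_continuous_of_separatesPoints
      (aeval c).range (fun u v huv => by
        obtain ⟨j, hj⟩ : ∃ j, u.1 j ≠ v.1 j := by
          by_contra! h
          exact huv (Subtype.ext (PiLp.ext h))
        exact ⟨c j, ⟨c j, ⟨X j, by simp⟩, rfl⟩, hj⟩) F hF ε hε
  refine ⟨p, fun u => ?_⟩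
  have h1 := hp u
  have h2 : (aeval c p : C(_, ℝ)) u = eval (fun j => u.1 j) p := by
    rw [← ContinuousMap.evalAlgHom_apply ℝ ℝ u, ← AlgHom.comp_apply, comp_aeval,
      ← coe_aeval_eq_eval]
    rfl
  rw [← h2]
  exact h1

theorem sum_range_odd_part (a : ℕ → ℝ) (m : ℕ) :
    ∑ k ∈ Finset.range m, a (2 * k + 1) =
      2⁻¹ * ∑ j ∈ Finset.range (2 * m), (1 - (-1) ^ j) * a j := by
  induction m with
  | zero => simp
  | succ m ih =>
    rw [Finset.sum_range_succ, ih, Nat.mul_succ, Finset.sum_range_succ, Finset.sum_range_succ]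
    simp [pow_succ, pow_mul]
    ring

/-- The odd part of a polynomial agrees on the unit sphere with a form of odd degree. -/
theorem exists_isHomogeneous_eval_eq_odd_part {n m : ℕ} {p : MvPolynomial (Fin n) ℝ}
    (hp : p.totalDegree ≤ m) :
    ∃ q : MvPolynomial (Fin n) ℝ, q.IsHomogeneous (2 * m + 1) ∧
      ∀ u : Metric.sphere (0 : EuclideanSpace ℝ (Fin n)) 1, eval (fun j => u.1 j) q =
        2⁻¹ * (eval (fun j => u.1 j) p - eval (fun j => (-u).1 j) p) := by
  refine ⟨∑ k ∈ Finset.range (m + 1),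
    homogeneousComponent (2 * k + 1) p * (∑ j, X j ^ 2) ^ (m - k), ?_, fun u => ?_⟩
  · refine IsHomogeneous.sum _ _ _ fun k hk => ?_
    have hkm : k ≤ m := Nat.lt_succ_iff.mp (Finset.mem_range.mp hk)
    have h := (homogeneousComponent_isHomogeneous (2 * k + 1) p).mul
      ((IsHomogeneous.sum Finset.univ (fun j : Fin n => (X j ^ 2 : MvPolynomial (Fin n) ℝ)) 2
        fun j _ => isHomogeneous_X_pow j 2).pow (m - k))
    convert h using 1
    omega
  · have hu : ∑ j, u.1 j ^ 2 = 1 := by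
      rw [← EuclideanSpace.real_norm_sq_eq, norm_eq_of_mem_sphere u, one_pow]
    have hsum : p = ∑ j ∈ Finset.range (2 * (m + 1)), homogeneousComponent j p := by
      conv_lhs => rw [← sum_homogeneousComponent p]
      refine Finset.sum_subset (Finset.range_subset_range.mpr (by omega)) fun j _ hj => ?_
      refine homogeneousComponent_eq_zero _ _ ?_
      rw [Finset.mem_range] at hj
      omega
    have hneg (j) : eval (fun i => (-u).1 i) (homogeneousComponent j p) =
        (-1) ^ j * eval (fun i => u.1 i) (homogeneousComponent j p) := by
      rw [← (homogeneousComponent_isHomogeneous j p).eval_mul_left]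
      simp
    have h1 := sum_range_odd_part (fun j => eval (fun i => u.1 i) (homogeneousComponent j p))
      (m + 1)
    simp only [map_sum, map_mul, map_pow, eval_X, hu, one_pow, mul_one]
    rw [h1]
    conv_rhs => rw [hsum]
    simp only [map_sum, hneg, sub_mul, one_mul, Finset.sum_sub_distrib]

end MvPolynomial

/-- The Borsuk–Ulam theorem for odd maps. -/
theorem exists_eq_zero_of_odd_sphere {n : ℕ}
    {F : Metric.sphere (0 : EuclideanSpace ℝ (Fin (n + 1))) 1 → EuclideanSpace ℝ (Fin n)}
    (hF : Continuous F) (hodd : ∀ u, F (-u) = -F u) : ∃ u, F u = 0 := by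
  have happrox (ε : ℝ) (hε : 0 < ε) : ∃ u, ∀ i, |F u i| ≤ 2 * ε := by
    choose p hp using fun i : Fin n =>
      MvPolynomial.exists_eval_near_of_continuous (F := fun u => F u i) (by fun_prop) hε
    choose q hq hqe using fun i : Fin n =>
      MvPolynomial.exists_isHomogeneous_eval_eq_odd_part (p := p i)
        (Finset.le_sup (f := fun i => (p i).totalDegree) (Finset.mem_univ i))
    obtain ⟨u, hu⟩ := MvPolynomial.exists_sphere_abs_eval_le (odd_two_mul_add_one _) hq hε
    refine ⟨u, fun i => ?_⟩
    have h1 := abs_lt.mp (hp i u)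
    have h2 := abs_lt.mp (hp i (-u))
    have h3 := abs_le.mp (hu i)
    rw [hqe] at h3
    have h4 : F (-u) i = - F u i := by rw [hodd]; rfl
    rw [abs_le]
    constructor <;> linarith
  have hcompact : CompactSpace (Metric.sphere (0 : EuclideanSpace ℝ (Fin (n + 1))) 1) :=
    isCompact_iff_compactSpace.mp (isCompact_sphere _ _)
  obtain ⟨u₀, -⟩ := happrox 1 one_pos
  obtain ⟨u, -, hu⟩ := isCompact_univ.exists_isMinOn ⟨u₀, Set.mem_univ _⟩
    (f := fun u => ∑ i, |F u i|) (by fun_prop)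
  refine ⟨u, ?_⟩
  have hle : ∑ i, |F u i| ≤ 0 := by
    refine le_of_forall_pos_le_add fun ε hε => ?_
    obtain ⟨v, hv⟩ := happrox (ε / (2 * (n + 1))) (by positivity)
    calc ∑ i, |F u i| ≤ ∑ i, |F v i| := hu (Set.mem_univ v)
      _ ≤ ∑ _i : Fin n, 2 * (ε / (2 * (n + 1))) := Finset.sum_le_sum fun i _ => hv i
      _ = n * ε / (n + 1) := by simp; field_simp
      _ ≤ 0 + ε := by
        rw [div_le_iff₀ (by positivity)]
        nlinarith
  ext i
  have h0 := (Finset.sum_eq_zero_iff_of_nonneg (fun i _ => abs_nonneg (F u i))).mp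
    (hle.antisymm (Finset.sum_nonneg fun i _ => abs_nonneg _)) i (Finset.mem_univ i)
  simpa using h0

/-- (Borsuk–Ulam type statement for convex bodies.) Let `B` be a compact
convex subset of `ℝ^{n+1}` with nonempty interior, `p` a point of the interior of `B`, and
`f` a continuous map from the frontier of `B` to `ℝⁿ`. Then there are points `x, y` of the
frontier of `B`, antipodal with respect to `p` (i.e. `p` lies in the open segment from `x`
to `y`), with `f x = f y`. -/
theorem exists_antipodal_pair_eq_image
    (n : ℕ) (hn : 0 < n)
    (B : Set (EuclideanSpace ℝ (Fin (n + 1))))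
    (hB_compact : IsCompact B) (hB_convex : Convex ℝ B)
    (p : EuclideanSpace ℝ (Fin (n + 1))) (hp : p ∈ interior B)
    (f : frontier B → EuclideanSpace ℝ (Fin n)) (hf : Continuous f) :
    ∃ x y : frontier B,
      p ∈ openSegment ℝ (x : EuclideanSpace ℝ (Fin (n + 1))) (y : EuclideanSpace ℝ (Fin (n + 1)))
      ∧ f x = f y := by
  let s : Set (EuclideanSpace ℝ (Fin (n + 1))) := (Homeomorph.addLeft p) ⁻¹' B
  have hs_convex : Convex ℝ s := hB_convex.translate_preimage_right p
  have hs_compact : IsCompact s := (Homeomorph.addLeft p).isCompact_preimage.mpr hB_compact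
  have hs_nhds : s ∈ nhds 0 :=
    (Homeomorph.addLeft p).continuous.continuousAt.preimage_mem_nhds
      (by simpa using mem_interior_iff_mem_nhds.mp hp)
  have hfront (v) : v ∈ frontier s ↔ p + v ∈ frontier B := by
    rw [← (Homeomorph.addLeft p).preimage_frontier]
    rfl
  have hpos (u : Metric.sphere (0 : EuclideanSpace ℝ (Fin (n + 1))) 1) : 0 < gauge s u.1 :=
    (gauge_pos (absorbent_nhds_zero hs_nhds)
      (NormedSpace.isVonNBounded_of_isBounded ℝ hs_compact.isBounded)).mpr
      (ne_zero_of_mem_unit_sphere u)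
  have hmem (u : Metric.sphere (0 : EuclideanSpace ℝ (Fin (n + 1))) 1) :
      p + (gauge s u.1)⁻¹ • u.1 ∈ frontier B := by
    rw [← hfront, ← gauge_eq_one_iff_mem_frontier hs_convex hs_nhds,
      gauge_smul_of_nonneg (inv_nonneg.mpr (hpos u).le), smul_eq_mul,
      inv_mul_cancel₀ (hpos u).ne']
  have hgauge := continuous_gauge hs_convex hs_nhds
  let r : Metric.sphere (0 : EuclideanSpace ℝ (Fin (n + 1))) 1 → frontier B :=
    fun u => ⟨p + (gauge s u.1)⁻¹ • u.1, hmem u⟩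
  have hr : Continuous r := by
    have hinv : Continuous fun u : Metric.sphere (0 : EuclideanSpace ℝ (Fin (n + 1))) 1 =>
        (gauge s u.1)⁻¹ :=
      (hgauge.comp continuous_subtype_val).inv₀ fun u => (hpos u).ne'
    exact (continuous_const.add (hinv.smul continuous_subtype_val)).subtype_mk _
  obtain ⟨u, hu⟩ := exists_eq_zero_of_odd_sphere (F := fun u => f (r u) - f (r (-u)))
    ((hf.comp hr).sub (hf.comp (hr.comp continuous_neg))) (fun u => by simp)
  refine ⟨r u, r (-u), ?_, sub_eq_zero.mp hu⟩
  have h1 := hpos u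
  have h2 := hpos (-u)
  refine ⟨gauge s u.1 / (gauge s u.1 + gauge s (-u).1),
    gauge s (-u).1 / (gauge s u.1 + gauge s (-u).1), by positivity, by positivity,
    by field_simp, ?_⟩
  ext j
  simp only [r, PiLp.add_apply, PiLp.smul_apply, smul_eq_mul]
  have h3 : (-u).1 j = - u.1 j := rfl
  rw [h3]
  field_simp
  ring
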